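/- For a differentiable family of positive definite density matrices ρ_t on [0,T], T ≥ |S(ρ_T) − S(ρ_0)|² / ∫₀ᵀ (‖ρ̇_t‖_HS · ‖ln ρ_t‖_HS)² dt, assuming the integral is positive. -/

import Mathlib

noncomputable section

open Matrix MeasureTheory
open scoped ComplexOrder

def matLog {n : Type*} [Fintype n] [DecidableEq n] (A : Matrix n n ℂ) : Matrix n n ℂ :=
  cfc Real.log A

def hsNorm {n : Type*} [Fintype n] (A : Matrix n n ℂ) : ℝ :=
  Real.sqrt (Matrix.trace (Aᴴ * A)).re

def trNorm {n : Type*} [Fintype n] [DecidableEq n] (A : Matrix n n ℂ) : ℝ :=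
  (Matrix.trace (cfc Real.sqrt (Aᴴ * A))).re

def opNorm {n : Type*} [Fintype n] [DecidableEq n] {A : Matrix n n ℂ}
    (hA : A.IsHermitian) : ℝ :=
  ⨆ i, |hA.eigenvalues i|

def vnEntropy {n : Type*} [Fintype n] [DecidableEq n] (ρ : Matrix n n ℂ) : ℝ :=
  -(Matrix.trace (ρ * matLog ρ)).re

def maxInfo {n : Type*} [Fintype n] [DecidableEq n] (ρ : Matrix n n ℂ) : ℝ :=
  Real.log (Fintype.card n) - vnEntropy ρ

def deph {n : Type*} [DecidableEq n] (A : Matrix n n ℂ) : Matrix n n ℂ :=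
  Matrix.diagonal (fun i => A i i)

def relEntCoh {n : Type*} [Fintype n] [DecidableEq n] (ρ : Matrix n n ℂ) : ℝ :=
  vnEntropy (deph ρ) - vnEntropy ρ


lemma trace_mul_re_eq_sum {m : Type*} [Fintype m] (A B : Matrix m m ℂ) :
    (trace (A * B)).re = ∑ i, ∑ j, (A i j * B j i).re := by
  simp [trace, mul_apply]

lemma hsNorm_sq {m : Type*} [Fintype m] (A : Matrix m m ℂ) :
    hsNorm A ^ 2 = ∑ i, ∑ j, ‖A i j‖ ^ 2 := by
  have h : (trace (Aᴴ * A)).re = ∑ i, ∑ j, ‖A i j‖ ^ 2 := by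
    rw [trace_mul_re_eq_sum, Finset.sum_comm]
    refine Finset.sum_congr rfl fun i _ => Finset.sum_congr rfl fun j _ => ?_
    rw [conjTranspose_apply, Complex.star_def, Complex.conj_mul']
    norm_cast
  rw [hsNorm, Real.sq_sqrt (h ▸ by positivity), h]

/-- Cauchy–Schwarz inequality for the Hilbert–Schmidt norm. -/
lemma trace_mul_re_sq_le {m : Type*} [Fintype m] (A B : Matrix m m ℂ) :
    (trace (A * B)).re ^ 2 ≤ (hsNorm A * hsNorm B) ^ 2 := by
  have hB : hsNorm B ^ 2 = ∑ p : m × m, ‖B p.2 p.1‖ ^ 2 := by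
    rw [hsNorm_sq, Fintype.sum_prod_type, Finset.sum_comm]
  rw [mul_pow, hsNorm_sq A, hB, ← Fintype.sum_prod_type' (f := fun i j => ‖A i j‖ ^ 2)]
  refine le_trans ?_ (Finset.sum_mul_sq_le_sq_mul_sq _ _ _)
  rw [trace_mul_re_eq_sum, ← Fintype.sum_prod_type' (f := fun i j => (A i j * B j i).re)]
  refine sq_le_sq' ?_ ?_
  · rw [neg_le, ← Finset.sum_neg_distrib]
    refine Finset.sum_le_sum fun p _ => ?_
    rw [← norm_mul]
    exact (neg_le_abs _).trans (Complex.abs_re_le_norm _)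
  · refine Finset.sum_le_sum fun p _ => ?_
    rw [← norm_mul]
    exact (le_abs_self _).trans (Complex.abs_re_le_norm _)

section Klein

variable {m : Type*} [Fintype m] [DecidableEq m]

lemma exists_trace_cfc_mul_cfc {A B : Matrix m m ℂ} (hA : A.IsHermitian) (hB : B.IsHermitian) :
    ∃ w : m → m → ℝ, (∀ i j, 0 ≤ w i j) ∧ ∀ f g : ℝ → ℝ,
      (trace (cfc f A * cfc g B)).re =
        ∑ i, ∑ j, w i j * (f (hA.eigenvalues i) * g (hB.eigenvalues j)) := by
  set U : Matrix m m ℂ := hA.eigenvectorUnitary.1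
  set V : Matrix m m ℂ := hB.eigenvectorUnitary.1
  refine ⟨fun i j => ‖(star U * V) i j‖ ^ 2, fun i j => by positivity, fun f g => ?_⟩
  have h : trace (cfc f A * cfc g B) =
      trace (diagonal (RCLike.ofReal ∘ f ∘ hA.eigenvalues) * (star U * V) *
        (diagonal (RCLike.ofReal ∘ g ∘ hB.eigenvalues) * star (star U * V))) := by
    rw [hA.cfc_eq, hB.cfc_eq, IsHermitian.cfc, IsHermitian.cfc, Unitary.conjStarAlgAut_apply,
      Unitary.conjStarAlgAut_apply]
    simp only [star_mul, star_star, mul_assoc]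
    rw [trace_mul_comm]
    simp only [mul_assoc, U, V]
  rw [h, trace_mul_re_eq_sum]
  refine Finset.sum_congr rfl fun i _ => Finset.sum_congr rfl fun j _ => ?_
  rw [diagonal_mul, diagonal_mul, star_apply, Complex.star_def]
  have e : ∀ a b z : ℂ, a * z * (b * (starRingEnd ℂ) z) = (‖z‖ ^ 2 : ℂ) * (a * b) := by
    intro a b z
    rw [← Complex.mul_conj']
    ring
  rw [e]
  simp only [Function.comp_apply, Complex.coe_algebraMap]
  norm_cast

/-- Klein's inequality for positive definite matrices of equal trace. -/
lemma trace_mul_matLog_le {A B : Matrix m m ℂ} (hA : A.PosDef) (hB : B.PosDef)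
    (htr : A.trace = B.trace) :
    (trace (A * matLog B)).re ≤ (trace (A * matLog A)).re := by
  obtain ⟨w, hw, h⟩ := exists_trace_cfc_mul_cfc hA.1 hB.1
  have hA' : IsSelfAdjoint A := hA.1
  have hB' : IsSelfAdjoint B := hB.1
  have h₁ := h id Real.log
  have h₂ := h (fun x => x * Real.log x) (fun _ => 1)
  have h₃ := h id (fun _ => 1)
  have h₄ := h (fun _ => 1) id
  rw [cfc_id ℝ A] at h₁ h₃
  rw [cfc_id ℝ B] at h₄
  rw [cfc_const_one ℝ B, mul_one] at h₂ h₃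
  rw [cfc_const_one ℝ A, one_mul] at h₄
  have e : cfc (fun x => x * Real.log x) A = A * matLog A := by
    have hs : ContinuousOn Real.log (spectrum ℝ A) :=
      (A.finite_real_spectrum).continuousOn _
    rw [matLog, cfc_mul (fun x => x) Real.log A, cfc_id' ℝ A]
  rw [e] at h₂
  rw [matLog, h₁, h₂]
  have key : ∀ i j, w i j * (hA.1.eigenvalues i * Real.log (hB.1.eigenvalues j)) ≤
      w i j * (hA.1.eigenvalues i * Real.log (hA.1.eigenvalues i) * 1) -
        (w i j * (hA.1.eigenvalues i * 1) - w i j * (1 * hB.1.eigenvalues j)) := by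
    intro i j
    have ha := hA.eigenvalues_pos i
    have hb := hB.eigenvalues_pos j
    have hl := Real.log_le_sub_one_of_pos (div_pos hb ha)
    rw [Real.log_div hb.ne' ha.ne'] at hl
    have hl' := mul_le_mul_of_nonneg_left hl ha.le
    have : hA.1.eigenvalues i * (hB.1.eigenvalues j / hA.1.eigenvalues i - 1) =
        hB.1.eigenvalues j - hA.1.eigenvalues i := by field_simp
    rw [this] at hl'
    nlinarith [mul_le_mul_of_nonneg_left hl' (hw i j)]
  have hsum := Finset.sum_le_sum fun i (_ : i ∈ Finset.univ) =>
    Finset.sum_le_sum fun j (_ : j ∈ Finset.univ) => key i j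
  simp only [Finset.sum_sub_distrib] at hsum
  simp only [id] at h₃ h₄ ⊢
  rw [← h₃, ← h₄, htr, sub_self, sub_zero] at hsum
  exact hsum

open scoped Matrix.Norms.L2Operator in
lemma continuous_matLog_comp {X : Type*} [TopologicalSpace X] {ρ : X → Matrix m m ℂ}
    (hρ : Continuous ρ) (hpd : ∀ x, (ρ x).PosDef) : Continuous fun x => matLog (ρ x) :=
  CFC.continuousOn_log.comp_continuous hρ fun x => ⟨(hpd x).1, (hpd x).isUnit⟩

lemma hasDerivAt_vnEntropy {ρ : ℝ → Matrix m m ℂ} {ρ' : Matrix m m ℂ} {s : ℝ}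
    (hpd : ∀ t, (ρ t).PosDef) (htr : ∀ t, (ρ t).trace = 1) (hρ : Continuous ρ)
    (hd : ∀ i j, HasDerivAt (fun t => ρ t i j) (ρ' i j) s) :
    HasDerivAt (fun t => vnEntropy (ρ t)) (-(trace (ρ' * matLog (ρ s))).re) s := by
  set φ : ℝ → ℝ := fun t => -(trace (ρ t * matLog (ρ s))).re with hφdef
  have hφ : HasDerivAt φ (-(trace (ρ' * matLog (ρ s))).re) s := by
    simp only [hφdef, trace_mul_re_eq_sum]
    refine (HasDerivAt.fun_sum fun i _ => HasDerivAt.fun_sum fun j _ => ?_).fun_neg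
    have := (hd i j).mul_const (matLog (ρ s) j i)
    exact (Complex.reCLM.hasFDerivAt.comp_hasDerivAt s this)
  have hψ : (fun t => (trace ((ρ t - ρ s) * (matLog (ρ t) - matLog (ρ s)))).re)
      =o[nhds s] fun t => t - s := by
    simp only [trace_mul_re_eq_sum]
    refine Asymptotics.IsLittleO.fun_sum fun i _ => Asymptotics.IsLittleO.fun_sum fun j _ => ?_
    have h₁ : (fun t => ρ t i j - ρ s i j) =O[nhds s] fun t => t - s :=
      (hd i j).differentiableAt.isBigO_sub
    have h₂ : (fun t => matLog (ρ t) j i - matLog (ρ s) j i) =o[nhds s] fun _ => (1 : ℝ) := by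
      rw [Asymptotics.isLittleO_one_iff, tendsto_sub_nhds_zero_iff]
      exact ((continuous_matLog_comp hρ hpd).matrix_elem j i).tendsto s
    have h₃ := h₁.mul_isLittleO h₂
    simp only [mul_one] at h₃
    refine Asymptotics.IsBigO.trans_isLittleO ?_ h₃
    exact Asymptotics.isBigO_of_le _ fun t => Complex.abs_re_le_norm _
  have hdiff : HasDerivAt (fun t => vnEntropy (ρ t) - φ t) 0 s := by
    rw [hasDerivAt_iff_isLittleO]
    refine Asymptotics.IsBigO.trans_isLittleO (Asymptotics.isBigO_of_le _ fun t => ?_) hψ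
    have h₁ := trace_mul_matLog_le (hpd t) (hpd s) ((htr t).trans (htr s).symm)
    have h₂ := trace_mul_matLog_le (hpd s) (hpd t) ((htr s).trans (htr t).symm)
    simp only [hφdef, vnEntropy, smul_zero, sub_zero, sub_mul, mul_sub, trace_sub, Complex.sub_re,
      Real.norm_eq_abs]
    rw [abs_le, abs_of_nonneg (by linarith)]
    constructor <;> linarith
  simpa using hdiff.fun_add hφ

end Klein

lemma sq_intervalIntegral_le {f : ℝ → ℝ} (hf : Continuous f) {T : ℝ} (hT : 0 < T) :
    (∫ t in (0 : ℝ)..T, f t) ^ 2 ≤ T * ∫ t in (0 : ℝ)..T, f t ^ 2 := by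
  set I := ∫ t in (0 : ℝ)..T, f t with hI
  have h : 0 ≤ ∫ t in (0 : ℝ)..T, (T * f t - I) ^ 2 :=
    intervalIntegral.integral_nonneg hT.le fun t _ => sq_nonneg _
  have e : ∫ t in (0 : ℝ)..T, (T * f t - I) ^ 2 =
      T * (T * (∫ t in (0 : ℝ)..T, f t ^ 2) - I ^ 2) := by
    have : ∀ t, (T * f t - I) ^ 2 = T ^ 2 * f t ^ 2 - 2 * T * I * f t + I ^ 2 := fun t => by ring
    simp only [this]
    rw [intervalIntegral.integral_add, intervalIntegral.integral_sub,
      intervalIntegral.integral_const_mul, intervalIntegral.integral_const_mul,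
      intervalIntegral.integral_const, ← hI, smul_eq_mul]
    · ring
    all_goals exact Continuous.intervalIntegrable (by fun_prop) _ _
  rw [e] at h
  linarith [nonneg_of_mul_nonneg_right h hT]

lemma continuous_hsNorm {m : Type*} [Fintype m] : Continuous (hsNorm : Matrix m m ℂ → ℝ) := by
  unfold hsNorm
  fun_prop

theorem entropy_action_speed_limit {n : Type*} [Fintype n] [DecidableEq n]
    (ρ ρ' : ℝ → Matrix n n ℂ) (T : ℝ) (hT : 0 < T)
    (hpd : ∀ t, (ρ t).PosDef) (htr : ∀ t, (ρ t).trace = 1)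
    (hd : ∀ t i j, HasDerivAt (fun s => ρ s i j) (ρ' t i j) t)
    (hc : ∀ i j, Continuous fun t => ρ' t i j)
    (hpos : 0 < ∫ t in (0:ℝ)..T, (hsNorm (ρ' t) * hsNorm (matLog (ρ t))) ^ 2) :
    |vnEntropy (ρ T) - vnEntropy (ρ 0)| ^ 2 /
      (∫ t in (0:ℝ)..T, (hsNorm (ρ' t) * hsNorm (matLog (ρ t))) ^ 2) ≤ T := by
  have hρ : Continuous ρ := continuous_matrix fun i j =>
    continuous_iff_continuousAt.2 fun t => (hd t i j).continuousAt
  have hρ' : Continuous ρ' := continuous_matrix hc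
  have hL := continuous_matLog_comp hρ hpd
  have hg : Continuous fun t => (hsNorm (ρ' t) * hsNorm (matLog (ρ t))) ^ 2 :=
    ((continuous_hsNorm.comp hρ').mul (continuous_hsNorm.comp hL)).pow 2
  have hf : Continuous fun t => -(trace (ρ' t * matLog (ρ t))).re :=
    (Complex.continuous_re.comp (hρ'.matrix_mul hL).matrix_trace).neg
  have hS := intervalIntegral.integral_eq_sub_of_hasDerivAt
    (fun t _ => hasDerivAt_vnEntropy hpd htr hρ (hd t)) (hf.intervalIntegrable 0 T)
  rw [div_le_iff₀ hpos, sq_abs, ← hS]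
  refine (sq_intervalIntegral_le hf hT).trans (mul_le_mul_of_nonneg_left ?_ hT.le)
  refine intervalIntegral.integral_mono_on hT.le ((hf.pow 2).intervalIntegrable _ _)
    (hg.intervalIntegrable _ _) fun t _ => ?_
  rw [neg_sq]
  exact trace_mul_re_sq_le _ _
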